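/- Let I ⊆ {1, …, |V|} and let s be a maximal string with respect to the grammar G_I. Then there exists i ∈ {1, …, |V|} \ I such that s = bexp_I(N_i). -/

import Mathlib

/-- A straight-line grammar (SLG) over terminal alphabet `T` with set of nonterminals `N`:
every nonterminal has exactly one production rule (symbols are `N ⊕ T`). -/
structure SLG (T : Type) (N : Type) where
  start : N
  rhs : N → List (N ⊕ T)

namespace SLG

variable {T N : Type}

/-- One rewriting step: replace one occurrence of a nonterminal by its right-hand side. -/
def Produces (G : SLG T N) (x y : List (N ⊕ T)) : Prop :=
  ∃ (p q : List (N ⊕ T)) (X : N),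
    x = p ++ Sum.inl X :: q ∧ y = p ++ G.rhs X ++ q

/-- The derivation relation of an SLG. -/
def Derives (G : SLG T N) : List (N ⊕ T) → List (N ⊕ T) → Prop :=
  Relation.ReflTransGen G.Produces

/-- `u` is the (necessarily unique) expansion `exp_G(X)` of the nonterminal `X`. -/
def IsExp (G : SLG T N) (X : N) (u : List T) : Prop :=
  G.Derives [Sum.inl X] (u.map Sum.inr)

/-- The language of an SLG; for an SLG it equals `{exp_G(S)}`. -/
def language (G : SLG T N) : Set (List T) :=
  { u | G.IsExp G.start u }

/-- `Y` occurs in the parse tree of `X`. -/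
def Reaches (G : SLG T N) : N → N → Prop :=
  Relation.ReflTransGen (fun X Y => Sum.inl Y ∈ G.rhs X)

/-- An SLG is admissible if every right-hand side consists of exactly two symbols and
every nonterminal occurs in the parse tree of the start symbol. -/
def Admissible (G : SLG T N) : Prop :=
  (∀ X, (G.rhs X).length = 2) ∧ (∀ X, G.Reaches G.start X)

/-- The size of an SLG: the total length of the right-hand sides of all its rules. -/
def size (G : SLG T N) [Fintype N] : ℕ :=
  ∑ X : N, (G.rhs X).length

end SLG

section Bexp

variable {T N : Type} {n : ℕ}

/-- The bounded expansion `bexp_I`, computed with explicit fuel (for an acyclic grammar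
with `n` nonterminals, fuel `n` always suffices).  The output symbols are symbols of the
grammar `G_I`: its nonterminals are `Option {i // i ∈ I}` (`some i` is `M_i`, `none` is `S`)
and its terminals are `Σ'' = T ⊕ Fin n ⊕ Fin (2n)` (terminals of `G`, dollars, hashes). -/
def bexpFuel (G : SLG T N) (e : Fin n ≃ N) (I : Finset (Fin n)) :
    ℕ → (N ⊕ T) → List ((Option {i : Fin n // i ∈ I}) ⊕ (T ⊕ Fin n ⊕ Fin (2 * n)))
  | _, Sum.inr t => [Sum.inr (Sum.inl t)]
  | 0, Sum.inl _ => []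
  | k + 1, Sum.inl X =>
    if h : e.symm X ∈ I then [Sum.inl (some ⟨e.symm X, h⟩)]
    else
      match G.rhs X with
      | [A, B] =>
          bexpFuel G e I k A
            ++ Sum.inr (Sum.inr (Sum.inl (e.symm X))) :: bexpFuel G e I k B
      | _ => []

/-- `bexp_I` applied to a symbol of `G`. -/
def bexp (G : SLG T N) (e : Fin n ≃ N) (I : Finset (Fin n)) (s : N ⊕ T) :
    List ((Option {i : Fin n // i ∈ I}) ⊕ (T ⊕ Fin n ⊕ Fin (2 * n))) :=
  bexpFuel G e I n s

/-- The grammar `G_I`: nonterminals `{S} ∪ {M_i : i ∈ I}`, rules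
`M_i → bexp_I(X) $_i bexp_I(Y)` (where `N_i → X Y` in `G`) and
`S → ⨀_{i=1..|V|} bexp_I(N_i) · #_{2i-1} · bexp_I(N_i) · #_{2i}`. -/
def GI (G : SLG T N) (e : Fin n ≃ N) (I : Finset (Fin n)) :
    SLG (T ⊕ Fin n ⊕ Fin (2 * n)) (Option {i : Fin n // i ∈ I}) where
  start := none
  rhs := fun
    | none => (List.finRange n).flatMap fun i =>
        bexp G e I (Sum.inl (e i))
          ++ Sum.inr (Sum.inr (Sum.inr (⟨2 * i.val, by have := i.isLt; omega⟩ : Fin (2 * n))))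
          :: bexp G e I (Sum.inl (e i))
          ++ [Sum.inr (Sum.inr (Sum.inr
                (⟨2 * i.val + 1, by have := i.isLt; omega⟩ : Fin (2 * n))))]
    | some j =>
        match G.rhs (e j.1) with
        | [A, B] =>
            bexp G e I A ++ Sum.inr (Sum.inr (Sum.inl j.1)) :: bexp G e I B
        | _ => []

end Bexp

section Greedy

variable {A B : Type}

/-- The number of non-overlapping occurrences of `p` in a list, found by the greedy
left-to-right scan (after finding an occurrence at position `i`, the search resumes at
position `i + |p|`). -/
def greedyCount [DecidableEq A] (p : List A) : List A → ℕ
  | [] => 0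
  | a :: t =>
    if p ≠ [] ∧ p <+: (a :: t) then 1 + greedyCount p (t.drop (p.length - 1))
    else greedyCount p t
termination_by l => l.length
decreasing_by
  · simp only [List.length_drop, List.length_cons]; omega
  · simp only [List.length_cons]; omega

/-- Replace the greedily found non-overlapping occurrences of `p` in a list by the single
symbol `c`, mapping all remaining symbols by `f`. -/
def greedyReplace [DecidableEq A] (p : List A) (c : B) (f : A → B) : List A → List B
  | [] => []
  | a :: t =>
    if p ≠ [] ∧ p <+: (a :: t) then c :: greedyReplace p c f (t.drop (p.length - 1))
    else f a :: greedyReplace p c f t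
termination_by l => l.length
decreasing_by
  · simp only [List.length_drop, List.length_cons]; omega
  · simp only [List.length_cons]; omega

end Greedy

namespace SLG

variable {T N : Type}

/-- Total number of non-overlapping occurrences of the string `s` on the right-hand side
of the grammar `H` (greedy left-to-right scan of the definition of every nonterminal). -/
def rhsOccs [Fintype N] [DecidableEq N] [DecidableEq T] (H : SLG T N)
    (s : List (N ⊕ T)) : ℕ :=
  ∑ X : N, greedyCount s (H.rhs X)

/-- `s` is a maximal string with respect to the grammar `H`: it has length at least two,
it has at least two non-overlapping occurrences on the right-hand side of `H`, and no
strictly longer string has at least as many non-overlapping occurrences. -/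
def IsMaximal [Fintype N] [DecidableEq N] [DecidableEq T] (H : SLG T N)
    (s : List (N ⊕ T)) : Prop :=
  2 ≤ s.length ∧ 2 ≤ H.rhsOccs s ∧
    ∀ s' : List (N ⊕ T), s.length < s'.length → H.rhsOccs s' < H.rhsOccs s

/-- A single step of a global algorithm on `H` with chosen maximal string `s`: a fresh
nonterminal (modelled by `none : Option N`) gets `s` as its definition, and the
non-overlapping occurrences of `s` (greedy left-to-right scan) on every right-hand side
are replaced by it. -/
def globalStep [DecidableEq N] [DecidableEq T] (H : SLG T N) (s : List (N ⊕ T)) :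
    SLG T (Option N) where
  start := some H.start
  rhs := fun
    | some X => greedyReplace s (Sum.inl none) (Sum.map some id) (H.rhs X)
    | none => s.map (Sum.map some id)

/-- Isomorphism of SLGs over a common terminal alphabet: a bijection of the nonterminals
(extended by the identity on terminals) mapping start symbol to start symbol and the
right-hand side of every nonterminal symbol-by-symbol onto the right-hand side of its
image. -/
def Isomorphic {N₁ N₂ : Type} (H₁ : SLG T N₁) (H₂ : SLG T N₂) : Prop :=
  ∃ g : N₁ ≃ N₂, g H₁.start = H₂.start ∧
    ∀ X, H₂.rhs (g X) = (H₁.rhs X).map (Sum.map g id)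

/-- Renaming the nonterminals of an SLG along a bijection. -/
def relabel {N₁ N₂ : Type} (H : SLG T N₁) (g : N₁ ≃ N₂) : SLG T N₂ where
  start := g H.start
  rhs Y := (H.rhs (g.symm Y)).map (Sum.map g id)

end SLG

/-- The initial grammar of a global algorithm on the input string `w`: a single
nonterminal whose definition is `w`. -/
def initSLG {T : Type} (w : List T) : SLG T (Fin 1) where
  start := 0
  rhs _ := w.map Sum.inr

/-- `Gs` is (the trace of) a run of `K` steps of a global algorithm on the input
string `w`: it starts with the one-rule grammar for `w` and each step replaces some
maximal string of the current grammar (after each step the nonterminals are renamed to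
`Fin (k + 2)`, which keeps a uniform indexing and does not change the grammar up to
isomorphism). -/
def IsGlobalRun {T : Type} [DecidableEq T] (w : List T) (K : ℕ)
    (Gs : (k : ℕ) → SLG T (Fin (k + 1))) : Prop :=
  Gs 0 = initSLG w ∧
  ∀ k < K, ∃ s, (Gs k).IsMaximal s ∧
    Gs (k + 1) = ((Gs k).globalStep s).relabel (finSuccEquiv (k + 1)).symm

section Lists

variable {A : Type}

theorem List.IsPrefix.left_of_append_cons {p u v : List A} {c : A}
    (h : p <+: u ++ c :: v) (hc : c ∉ p) : p <+: u := by
  have h' : u ++ [c] <+: u ++ c :: v := ⟨v, by simp⟩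
  rcases le_total p.length (u ++ [c]).length with hle | hle
  · rcases List.prefix_concat_iff.1 (List.prefix_of_prefix_length_le h h' hle) with h2 | h2
    · exact absurd (by simp [h2]) hc
    · exact h2
  · exact absurd ((List.prefix_of_prefix_length_le h' h hle).subset (by simp)) hc

theorem List.IsInfix.of_append_cons {p u v : List A} {c : A}
    (h : p <:+: u ++ c :: v) (hc : c ∉ p) : p <:+: u ∨ p <:+: v := by
  induction u with
  | nil =>
    rcases List.infix_cons_iff.1 h with h1 | h1
    · exact Or.inl (List.IsPrefix.left_of_append_cons (u := []) h1 hc).isInfix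
    · exact Or.inr h1
  | cons a t ih =>
    rcases List.infix_cons_iff.1 h with h1 | h1
    · exact Or.inl (List.IsPrefix.left_of_append_cons (u := a :: t) h1 hc).isInfix
    · exact (ih h1).imp_left fun h2 => List.infix_cons_iff.2 (Or.inr h2)

/-- Lists composed of chunks satisfying `Q`, separated by single letters satisfying `b`. -/
inductive SeparatedBy (Q : List A → Prop) (b : A → Prop) : List A → Prop
  | chunk (x : List A) : Q x → SeparatedBy Q b x
  | join (u v : List A) (c : A) :
      SeparatedBy Q b u → b c → SeparatedBy Q b v → SeparatedBy Q b (u ++ c :: v)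

theorem SeparatedBy.exists_chunk {Q : List A → Prop} {b : A → Prop} {w s : List A}
    (h : SeparatedBy Q b w) (hs : s <:+: w) (hb : ∀ c ∈ s, ¬ b c) : ∃ x, Q x ∧ s <:+: x := by
  induction h with
  | chunk x hx => exact ⟨x, hx, hs⟩
  | join u v c _ hc _ ihu ihv =>
    exact (hs.of_append_cons fun h => hb c h hc).elim ihu ihv

theorem List.IsPrefix.eq_append_drop_pred {p t : List A} {a : A} (h : p <+: a :: t) (hp : p ≠ []) :
    a :: t = p ++ t.drop (p.length - 1) := by
  obtain ⟨r, hr⟩ := h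
  cases p with
  | nil => exact absurd rfl hp
  | cons x p =>
    simp only [List.cons_append, List.cons.injEq] at hr
    simp [← hr.1, ← hr.2]

instance Sum.lawfulBEq {B : Type} [BEq A] [LawfulBEq A] [BEq B] [LawfulBEq B] :
    LawfulBEq (A ⊕ B) where
  eq_of_beq {a b} h := by
    cases a <;> cases b
    · exact congrArg Sum.inl (eq_of_beq h)
    · cases h
    · cases h
    · exact congrArg Sum.inr (eq_of_beq h)
  rfl {a} := by
    cases a
    · exact beq_self_eq_true (α := A) _
    · exact beq_self_eq_true (α := B) _

variable [DecidableEq A]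

theorem greedyCount_le_count [BEq A] [LawfulBEq A] {p : List A} {c : A} (hc : c ∈ p) (l : List A) :
    greedyCount p l ≤ l.count c := by
  induction l using greedyCount.induct p with
  | case1 => simp [greedyCount]
  | case2 a t h ih =>
    rw [greedyCount, if_pos h, h.2.eq_append_drop_pred h.1, List.count_append]
    have := List.count_pos_iff.2 hc
    omega
  | case3 a t h ih =>
    rw [greedyCount, if_neg h, List.count_cons]
    omega

theorem isInfix_of_greedyCount_pos {p : List A} (l : List A) (h : 0 < greedyCount p l) :
    p <:+: l := by
  induction l with
  | nil => simp [greedyCount] at h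
  | cons a t ih =>
    by_cases h' : p ≠ [] ∧ p <+: a :: t
    · exact h'.2.isInfix
    · rw [greedyCount, if_neg h'] at h
      exact List.infix_cons_iff.2 (Or.inr (ih h))

theorem greedyCount_self_pos {p : List A} (hp : p ≠ []) : 0 < greedyCount p p := by
  cases p with
  | nil => exact absurd rfl hp
  | cons a t =>
    rw [greedyCount, if_pos ⟨hp, List.prefix_rfl⟩]
    omega

theorem greedyCount_append_cons {p : List A} {c : A} (hc : c ∉ p) (u v : List A) :
    greedyCount p (u ++ c :: v) = greedyCount p u + greedyCount p v := by
  induction u using greedyCount.induct p with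
  | case1 =>
    have h : ¬ (p ≠ [] ∧ p <+: c :: v) := fun h =>
      h.1 (List.prefix_nil.1 (List.IsPrefix.left_of_append_cons (u := []) h.2 hc))
    rw [List.nil_append, greedyCount.eq_2, if_neg h]
    simp [greedyCount]
  | case2 a t h ih =>
    have hlen := h.2.length_le
    rw [List.length_cons] at hlen
    rw [List.cons_append, greedyCount, if_pos ⟨h.1, h.2.trans (List.prefix_append (a :: t) _)⟩,
      greedyCount, if_pos h, List.drop_append_of_le_length (by omega), ih, Nat.add_assoc]
  | case3 a t h ih =>
    rw [List.cons_append, greedyCount, if_neg, greedyCount, if_neg h, ih]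
    rintro ⟨h1, h2⟩
    exact h ⟨h1, List.IsPrefix.left_of_append_cons (u := a :: t) h2 hc⟩

theorem SeparatedBy.count_le_greedyCount [BEq A] [LawfulBEq A] {p w : List A} {a : A} {b : A → Prop}
    (hp : p.count a = 1) (hb : ∀ c ∈ p, ¬ b c) (hba : ¬ b a)
    (h : SeparatedBy (fun x => x = p ∨ a ∉ x) b w) : w.count a ≤ greedyCount p w := by
  induction h with
  | chunk x hx =>
    rcases hx with rfl | hx
    · rw [hp]
      exact greedyCount_self_pos (by rintro rfl; simp at hp)
    · simp [List.count_eq_zero_of_not_mem hx]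
  | join u v c _ hc _ ihu ihv =>
    have hca : c ≠ a := by rintro rfl; exact hba hc
    rw [greedyCount_append_cons fun h => hb c h hc, List.count_append, List.count_cons_of_ne hca]
    omega

end Lists

namespace SLG

variable {T N : Type}

/-- Big-step evaluation of a string of symbols to a string of terminals. -/
inductive Evaluates (G : SLG T N) : List (N ⊕ T) → List T → Prop
  | nil : Evaluates G [] []
  | terminal (t : T) (x : List (N ⊕ T)) (w : List T) :
      Evaluates G x w → Evaluates G (Sum.inr t :: x) (t :: w)
  | nonterminal (X : N) (x : List (N ⊕ T)) (u w : List T) :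
      Evaluates G (G.rhs X) u → Evaluates G x w → Evaluates G (Sum.inl X :: x) (u ++ w)

variable {G : SLG T N}

theorem Evaluates.map_inr (w : List T) : G.Evaluates (w.map Sum.inr) w := by
  induction w with
  | nil => exact .nil
  | cons t w ih => exact .terminal _ _ _ ih

theorem Evaluates.append {x y : List (N ⊕ T)} {u v : List T}
    (hx : G.Evaluates x u) (hy : G.Evaluates y v) : G.Evaluates (x ++ y) (u ++ v) := by
  induction hx with
  | nil => exact hy
  | terminal t x w _ ih => exact .terminal _ _ _ ih
  | nonterminal X x u w hX _ _ ih =>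
    rw [List.append_assoc]
    exact .nonterminal _ _ _ _ hX ih

theorem Evaluates.exists_of_append {x y : List (N ⊕ T)} {w : List T}
    (h : G.Evaluates (x ++ y) w) :
    ∃ u v, w = u ++ v ∧ G.Evaluates x u ∧ G.Evaluates y v := by
  induction x generalizing w with
  | nil => exact ⟨[], w, rfl, .nil, h⟩
  | cons a x ih =>
    cases h with
    | terminal t _ w h =>
      obtain ⟨u, v, rfl, hu, hv⟩ := ih h
      exact ⟨t :: u, v, rfl, .terminal _ _ _ hu, hv⟩
    | nonterminal X _ u' w hX h =>
      obtain ⟨u, v, rfl, hu, hv⟩ := ih h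
      exact ⟨u' ++ u, v, by simp, .nonterminal _ _ _ _ hX hu, hv⟩

theorem Evaluates.unique {x : List (N ⊕ T)} {u v : List T}
    (hu : G.Evaluates x u) (hv : G.Evaluates x v) : u = v := by
  induction hu generalizing v with
  | nil => cases hv; rfl
  | terminal t x w _ ih =>
    cases hv with
    | terminal _ _ w' h => rw [ih h]
  | nonterminal X x u w _ _ ih1 ih2 =>
    cases hv with
    | nonterminal _ _ u' w' h1 h2 => rw [ih1 h1, ih2 h2]

theorem Evaluates.length_le (h2 : ∀ X, (G.rhs X).length = 2) {x : List (N ⊕ T)} {w : List T}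
    (h : G.Evaluates x w) : x.length ≤ w.length := by
  induction h with
  | nil => simp
  | terminal t x w _ ih => simpa using ih
  | nonterminal X x u w _ _ ih1 ih2 =>
    rw [h2 X] at ih1
    simp only [List.length_cons, List.length_append]
    omega

theorem Derives.evaluates {x : List (N ⊕ T)} {w : List T}
    (h : G.Derives x (w.map Sum.inr)) : G.Evaluates x w := by
  induction h using Relation.ReflTransGen.head_induction_on with
  | refl => exact .map_inr w
  | head hstep _ ih =>
    obtain ⟨p, q, X, rfl, rfl⟩ := hstep
    obtain ⟨u, v, rfl, hu, hv⟩ := ih.exists_of_append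
    obtain ⟨u1, u2, rfl, hu1, hu2⟩ := hu.exists_of_append
    rw [List.append_assoc]
    exact hu1.append (.nonterminal _ _ _ _ hu2 hv)

theorem IsExp.evaluates_rhs {X : N} {w : List T} (h : G.IsExp X w) : G.Evaluates (G.rhs X) w := by
  have hev := Derives.evaluates h
  generalize hx : [Sum.inl X] = x at hev
  cases hev with
  | nil => simp at hx
  | terminal => simp at hx
  | nonterminal Y y u w hY hy =>
    obtain ⟨rfl, rfl⟩ : X = Y ∧ [] = y := by simpa using hx
    cases hy
    simpa using hY

theorem IsExp.length_lt (h2 : ∀ X, (G.rhs X).length = 2) {X Y : N} {u v : List T}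
    (hX : G.IsExp X u) (hY : G.IsExp Y v) (hmem : Sum.inl Y ∈ G.rhs X) :
    v.length < u.length := by
  have hev := hX.evaluates_rhs
  obtain ⟨p, q, hpq⟩ := List.append_of_mem hmem
  have hlen := h2 X
  rw [hpq] at hev hlen
  obtain ⟨a, b, rfl, ha, hb⟩ := hev.exists_of_append
  obtain ⟨c, d, rfl, hc, hd⟩ := Evaluates.exists_of_append (x := [Sum.inl Y]) (y := q) hb
  have := (Derives.evaluates hY).unique hc
  subst this
  have := ha.length_le h2
  have := hd.length_le h2
  simp only [List.length_append, List.length_cons] at *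
  omega

end SLG

section Bexp

variable {T N : Type} {n : ℕ}

/-- Every right-hand side has two symbols, and its nonterminals precede the left-hand side in
the enumeration `e`. -/
def IsTopological (G : SLG T N) (e : Fin n ≃ N) : Prop :=
  ∀ X, ∃ A B, G.rhs X = [A, B] ∧
    (∀ Y, A = Sum.inl Y → e.symm Y < e.symm X) ∧ (∀ Y, B = Sum.inl Y → e.symm Y < e.symm X)

theorem SLG.Admissible.isTopological {G : SLG T N} {e : Fin n ≃ N} (hG : G.Admissible)
    {expn : N → List T} (hexpn : ∀ X, G.IsExp X (expn X))
    (hord : ∀ i j : Fin n, i ≤ j → (expn (e i)).length ≤ (expn (e j)).length) :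
    IsTopological G e := by
  have key : ∀ X Y, Sum.inl Y ∈ G.rhs X → e.symm Y < e.symm X := by
    intro X Y h
    by_contra! hle
    have h1 := hord _ _ hle
    rw [e.apply_symm_apply, e.apply_symm_apply] at h1
    exact absurd ((hexpn X).length_lt hG.1 (hexpn Y) h) (by omega)
  intro X
  obtain ⟨A, B, hAB⟩ := List.length_eq_two.1 (hG.1 X)
  refine ⟨A, B, hAB, ?_, ?_⟩ <;> rintro Y rfl <;> exact key X Y (by simp [hAB])

variable {G : SLG T N} {e : Fin n ≃ N} {I : Finset (Fin n)}

/-- The symbol `$_i` of `G_I`. -/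
abbrev dollarSym (T : Type) (I : Finset (Fin n)) (i : Fin n) :
    Option {i : Fin n // i ∈ I} ⊕ (T ⊕ Fin n ⊕ Fin (2 * n)) :=
  Sum.inr (Sum.inr (Sum.inl i))

/-- The symbol `#_h` of `G_I`. -/
abbrev hashSym (T : Type) (I : Finset (Fin n)) (h : Fin (2 * n)) :
    Option {i : Fin n // i ∈ I} ⊕ (T ⊕ Fin n ⊕ Fin (2 * n)) :=
  Sum.inr (Sum.inr (Sum.inr h))

theorem bexpFuel_eq (hT : IsTopological G e) (k l : ℕ) (s : N ⊕ T)
    (hk : ∀ X, s = Sum.inl X → (e.symm X).val < k)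
    (hl : ∀ X, s = Sum.inl X → (e.symm X).val < l) :
    bexpFuel G e I k s = bexpFuel G e I l s := by
  induction k generalizing l s with
  | zero =>
    rcases s with X | t
    · exact absurd (hk X rfl) (by omega)
    · simp [bexpFuel]
  | succ k ih =>
    rcases s with X | t
    · have hk := hk X rfl
      have hl := hl X rfl
      obtain ⟨l, rfl⟩ : ∃ m, l = m + 1 := ⟨l - 1, by omega⟩
      obtain ⟨A, B, hAB, hA, hB⟩ := hT X
      simp only [bexpFuel, hAB]
      rw [ih l A (fun Y hY => ?_) (fun Y hY => ?_), ih l B (fun Y hY => ?_) (fun Y hY => ?_)]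
      · have := hB Y hY; omega
      · have := hB Y hY; omega
      · have := hA Y hY; omega
      · have := hA Y hY; omega
    · cases l <;> simp [bexpFuel]

theorem bexp_terminal (t : T) : bexp G e I (Sum.inr t) = [Sum.inr (Sum.inl t)] := by
  simp [bexp, bexpFuel]

theorem bexp_of_mem {i : Fin n} (hi : i ∈ I) :
    bexp G e I (Sum.inl (e i)) = [Sum.inl (some ⟨i, hi⟩)] := by
  obtain ⟨m, rfl⟩ : ∃ m, n = m + 1 := ⟨n - 1, by have := i.isLt; omega⟩
  simp [bexp, bexpFuel, hi]

theorem bexp_of_notMem (hT : IsTopological G e) {i : Fin n} (hi : i ∉ I) {A B : N ⊕ T}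
    (h : G.rhs (e i) = [A, B]) :
    bexp G e I (Sum.inl (e i)) = bexp G e I A ++ dollarSym T I i :: bexp G e I B := by
  obtain ⟨A', B', h', hA, hB⟩ := hT (e i)
  obtain ⟨rfl, rfl⟩ : A = A' ∧ B = B' := by simpa [h] using h'
  have hi' := i.isLt
  have hfuel : bexp G e I (Sum.inl (e i)) = bexpFuel G e I (i + 1) (Sum.inl (e i)) :=
    bexpFuel_eq hT _ _ _ (by simp) (by simp)
  have key : ∀ C : N ⊕ T, (∀ Y, C = Sum.inl Y → e.symm Y < e.symm (e i)) →
      bexpFuel G e I i C = bexp G e I C := fun C hC =>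
    bexpFuel_eq hT _ _ _ (fun Y hY => by simpa using hC Y hY) (fun Y _ => (e.symm Y).isLt)
  rw [hfuel]
  simp [bexpFuel, hi, h, key A hA, key B hB]

theorem bexp_induction (hT : IsTopological G e) {C : N ⊕ T → Prop}
    (terminal : ∀ t, C (Sum.inr t))
    (nonterminal : ∀ i A B, G.rhs (e i) = [A, B] →
      (∀ Y, A = Sum.inl Y → e.symm Y < i) → (∀ Y, B = Sum.inl Y → e.symm Y < i) →
      C A → C B → C (Sum.inl (e i)))
    (s : N ⊕ T) : C s := by
  have key : ∀ i, C (Sum.inl (e i)) := by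
    intro i
    induction i using WellFoundedLT.induction with
    | ind i ih =>
      obtain ⟨A, B, h, hA, hB⟩ := hT (e i)
      simp only [e.symm_apply_apply] at hA hB
      have aux : ∀ D : N ⊕ T, (∀ Y, D = Sum.inl Y → e.symm Y < i) → C D := by
        rintro (Y | t) hD
        · simpa using ih _ (hD Y rfl)
        · exact terminal t
      exact nonterminal i A B h hA hB (aux A hA) (aux B hB)
  rcases s with X | t
  · simpa using key (e.symm X)
  · exact terminal t

theorem hash_notMem_bexp (hT : IsTopological G e) (h : Fin (2 * n)) (s : N ⊕ T) :
    hashSym T I h ∉ bexp G e I s := by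
  induction s using bexp_induction hT with
  | terminal t => simp [bexp_terminal]
  | nonterminal i A B hAB _ _ ihA ihB =>
    by_cases hi : i ∈ I
    · simp [bexp_of_mem hi]
    · simp [bexp_of_notMem hT hi hAB, ihA, ihB]

theorem of_dollar_mem_bexp (hT : IsTopological G e) {k : Fin n} {s : N ⊕ T}
    (hk : dollarSym T I k ∈ bexp G e I s) : k ∉ I ∧ ∃ X, s = Sum.inl X ∧ k ≤ e.symm X := by
  induction s using bexp_induction hT with
  | terminal t => simp [bexp_terminal] at hk
  | nonterminal i A B hAB hA hB ihA ihB =>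
    by_cases hi : i ∈ I
    · simp [bexp_of_mem hi] at hk
    · simp only [bexp_of_notMem hT hi hAB, List.mem_append, List.mem_cons] at hk
      rcases hk with hk | hk | hk
      · obtain ⟨h1, X, rfl, h2⟩ := ihA hk
        exact ⟨h1, e i, rfl, by simpa using (h2.trans (hA X rfl).le)⟩
      · obtain rfl : k = i := by simpa using hk
        exact ⟨hi, e k, rfl, by simp⟩
      · obtain ⟨h1, X, rfl, h2⟩ := ihB hk
        exact ⟨h1, e i, rfl, by simpa using (h2.trans (hB X rfl).le)⟩

theorem dollar_notMem_bexp_of_lt (hT : IsTopological G e) {i : Fin n} {s : N ⊕ T}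
    (hs : ∀ Y, s = Sum.inl Y → e.symm Y < i) : dollarSym T I i ∉ bexp G e I s := by
  intro h
  obtain ⟨-, X, rfl, hle⟩ := of_dollar_mem_bexp hT h
  exact absurd (hs X rfl) (not_lt.2 hle)

theorem GI_rhs_some {j : {i : Fin n // i ∈ I}} {A B : N ⊕ T} (h : G.rhs (e j.1) = [A, B]) :
    (GI G e I).rhs (some j) = bexp G e I A ++ dollarSym T I j.1 :: bexp G e I B := by
  simp [GI, h]

theorem GI_rhs_none : (GI G e I).rhs none = (List.finRange n).flatMap fun i =>
    bexp G e I (Sum.inl (e i)) ++ hashSym T I ⟨2 * i.val, by have := i.isLt; omega⟩ ::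
      (bexp G e I (Sum.inl (e i)) ++ hashSym T I ⟨2 * i.val + 1, by have := i.isLt; omega⟩ :: []) := by
  simp [GI]

theorem separatedBy_GI_rhs (hT : IsTopological G e)
    {Q : List (Option {i : Fin n // i ∈ I} ⊕ (T ⊕ Fin n ⊕ Fin (2 * n))) → Prop}
    {b : Option {i : Fin n // i ∈ I} ⊕ (T ⊕ Fin n ⊕ Fin (2 * n)) → Prop}
    (hnil : Q []) (hterm : ∀ t, Q [Sum.inr (Sum.inl t)]) (hnon : ∀ j, Q [Sum.inl (some j)])
    (hhash : ∀ h, b (hashSym T I h))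
    (hdollar : ∀ i A B, G.rhs (e i) = [A, B] →
      (∀ Y, A = Sum.inl Y → e.symm Y < i) → (∀ Y, B = Sum.inl Y → e.symm Y < i) →
      SeparatedBy Q b (bexp G e I A) → SeparatedBy Q b (bexp G e I B) →
      SeparatedBy Q b (bexp G e I A ++ dollarSym T I i :: bexp G e I B))
    (X : Option {i : Fin n // i ∈ I}) : SeparatedBy Q b ((GI G e I).rhs X) := by
  have key : ∀ s, SeparatedBy Q b (bexp G e I s) := by
    intro s
    induction s using bexp_induction hT with
    | terminal t => rw [bexp_terminal]; exact .chunk _ (hterm t)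
    | nonterminal i A B hAB hA hB ihA ihB =>
      by_cases hi : i ∈ I
      · rw [bexp_of_mem hi]; exact .chunk _ (hnon _)
      · rw [bexp_of_notMem hT hi hAB]
        exact hdollar i A B hAB hA hB ihA ihB
  cases X with
  | none =>
    rw [GI_rhs_none]
    induction List.finRange n with
    | nil => exact .chunk _ hnil
    | cons i l ih =>
      rw [List.flatMap_cons, List.append_assoc, List.cons_append, List.append_assoc,
        List.cons_append, List.nil_append]
      exact .join _ _ _ (key _) (hhash _) (.join _ _ _ (key _) (hhash _) ih)
  | some j =>
    obtain ⟨A, B, hAB, hA, hB⟩ := hT (e j.1)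
    simp only [e.symm_apply_apply] at hA hB
    rw [GI_rhs_some hAB]
    exact hdollar j.1 A B hAB hA hB (key A) (key B)

variable [DecidableEq T]

theorem rhsOccs_le_sum_count {s : List (Option {i : Fin n // i ∈ I} ⊕ (T ⊕ Fin n ⊕ Fin (2 * n)))}
    {c : Option {i : Fin n // i ∈ I} ⊕ (T ⊕ Fin n ⊕ Fin (2 * n))} (hc : c ∈ s) :
    (GI G e I).rhsOccs s ≤ ∑ X, ((GI G e I).rhs X).count c :=
  Finset.sum_le_sum fun _ _ => greedyCount_le_count hc _

theorem sum_count_hash_le_one (hT : IsTopological G e) (h : Fin (2 * n)) :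
    ∑ X, ((GI G e I).rhs X).count (hashSym T I h) ≤ 1 := by
  have h0 : ∀ s, (bexp G e I s).count (hashSym T I h) = 0 := fun s =>
    List.count_eq_zero_of_not_mem (hash_notMem_bexp hT h s)
  have hsome : ∀ j, ((GI G e I).rhs (some j)).count (hashSym T I h) = 0 := by
    intro j
    obtain ⟨A, B, hAB, -, -⟩ := hT (e j.1)
    simp [GI_rhs_some hAB, h0]
  have hnone : ((GI G e I).rhs none).count (hashSym T I h) ≤
      ∑ i : Fin n, if i = ⟨h.val / 2, by have := h.isLt; omega⟩ then 1 else 0 := by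
    rw [GI_rhs_none, List.count_flatMap, ← List.ofFn_eq_map, List.sum_ofFn]
    refine Finset.sum_le_sum fun i _ => ?_
    simp only [Function.comp, List.count_append, List.count_cons, h0, List.count_nil, beq_iff_eq,
      Sum.inr.injEq, Fin.ext_iff]
    split_ifs <;> omega
  rw [Fintype.sum_option]
  simpa [hsome] using hnone

theorem sum_count_dollar_le_one (hT : IsTopological G e) {i : Fin n} (hi : i ∈ I) :
    ∑ X, ((GI G e I).rhs X).count (dollarSym T I i) ≤ 1 := by
  have h0 : ∀ s, (bexp G e I s).count (dollarSym T I i) = 0 := fun s =>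
    List.count_eq_zero_of_not_mem fun h => (of_dollar_mem_bexp hT h).1 hi
  have hsome : ∀ j, ((GI G e I).rhs (some j)).count (dollarSym T I i) =
      if j = ⟨i, hi⟩ then 1 else 0 := by
    intro j
    obtain ⟨A, B, hAB, -, -⟩ := hT (e j.1)
    simp [GI_rhs_some hAB, List.count_cons, h0, Subtype.ext_iff]
  have hnone : ((GI G e I).rhs none).count (dollarSym T I i) = 0 := by
    rw [GI_rhs_none]
    refine List.count_eq_zero_of_not_mem ?_
    simp [← List.count_eq_zero, h0]
  rw [Fintype.sum_option, hnone]
  simp [hsome]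

end Bexp

/-- Let `I ⊆ {1, …, |V|}` and let `s` be a maximal string with respect
to the grammar `G_I`.  Then there exists `i ∈ {1, …, |V|} \ I` with `s = bexp_I(N_i)`. -/
theorem maximal_string_is_bexp {T N : Type} [DecidableEq T] [Fintype N] {n : ℕ}
    (e : Fin n ≃ N) (G : SLG T N) (hG : G.Admissible)
    (expn : N → List T) (hexpn : ∀ X, G.IsExp X (expn X))
    (hord : ∀ i j : Fin n, i ≤ j → (expn (e i)).length ≤ (expn (e j)).length)
    (I : Finset (Fin n))
    (s : List ((Option {i : Fin n // i ∈ I}) ⊕ (T ⊕ Fin n ⊕ Fin (2 * n))))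
    (hs : (GI G e I).IsMaximal s) :
    ∃ i : Fin n, i ∉ I ∧ s = bexp G e I (Sum.inl (e i)) := by
  have hT := hG.isTopological hexpn hord
  obtain ⟨hs2, hocc, hmax⟩ := hs
  have hhash : ∀ h, hashSym T I h ∉ s := fun h hmem => by
    have := (rhsOccs_le_sum_count hmem).trans (sum_count_hash_le_one hT h)
    omega
  have hI : ∀ i, dollarSym T I i ∈ s → i ∉ I := fun i hmem hi => by
    have := (rhsOccs_le_sum_count hmem).trans (sum_count_dollar_le_one hT hi)
    omega
  obtain ⟨X, hX⟩ : ∃ X, s <:+: (GI G e I).rhs X := by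
    by_contra! hno
    have h0 : (GI G e I).rhsOccs s = 0 := Finset.sum_eq_zero fun X _ =>
      Nat.eq_zero_of_not_pos fun h => hno X (isInfix_of_greedyCount_pos _ h)
    omega
  have hdollar : ∃ i, dollarSym T I i ∈ s := by
    by_contra! hno
    have hsep := separatedBy_GI_rhs (I := I) hT (Q := fun x => x.length ≤ 1)
      (b := fun c => ∃ d, c = Sum.inr (Sum.inr d)) (by simp) (by simp) (by simp) (by simp)
      (fun i A B _ _ _ hA hB => .join _ _ _ hA ⟨_, rfl⟩ hB) X
    obtain ⟨x, hx, hsx⟩ := hsep.exists_chunk hX (by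
      rintro c hc ⟨d | d, rfl⟩
      · exact hno d hc
      · exact hhash d hc)
    have := hsx.length_le
    omega
  obtain ⟨i, hi, himax⟩ : ∃ i, dollarSym T I i ∈ s ∧ ∀ j, dollarSym T I j ∈ s → j ≤ i := by
    obtain ⟨k, hk⟩ := hdollar
    obtain ⟨i, hi, hle⟩ := (Set.toFinite {j | dollarSym T I j ∈ s}).toFinset.exists_max_image id
      ⟨k, by simpa using hk⟩
    exact ⟨i, by simpa using hi, fun j hj => hle j (by simpa using hj)⟩
  have hiI := hI i hi
  refine ⟨i, hiI, ?_⟩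
  set b : Option {i : Fin n // i ∈ I} ⊕ (T ⊕ Fin n ⊕ Fin (2 * n)) → Prop :=
    fun c => (∃ h, c = hashSym T I h) ∨ ∃ j, i < j ∧ c = dollarSym T I j with hb
  have hsep : ∀ X, SeparatedBy (fun x => x = bexp G e I (Sum.inl (e i)) ∨ dollarSym T I i ∉ x) b
      ((GI G e I).rhs X) := by
    refine separatedBy_GI_rhs hT (by simp) (by simp) (by simp) (by simp [hb]) ?_
    intro j A B hAB hA hB ihA ihB
    rcases lt_trichotomy j i with hj | rfl | hj
    · have h1 := dollar_notMem_bexp_of_lt (I := I) hT fun Y hY => (hA Y hY).trans hj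
      have h2 := dollar_notMem_bexp_of_lt (I := I) hT fun Y hY => (hB Y hY).trans hj
      exact .chunk _ (Or.inr (by simp [h1, h2, hj.ne']))
    · exact .chunk _ (Or.inl (bexp_of_notMem hT hiI hAB).symm)
    · exact .join _ _ _ ihA (Or.inr ⟨j, hj, rfl⟩) ihB
  have hsub : s <:+: bexp G e I (Sum.inl (e i)) := by
    obtain ⟨x, rfl | hx, hsx⟩ := (hsep X).exists_chunk hX (by
      rintro c hc (⟨h, rfl⟩ | ⟨j, hj, rfl⟩)
      · exact hhash h hc
      · exact absurd (himax j hc) (by simpa using hj))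
    · exact hsx
    · exact absurd (hsx.subset hi) hx
  have hle : (GI G e I).rhsOccs s ≤ (GI G e I).rhsOccs (bexp G e I (Sum.inl (e i))) := by
    refine (rhsOccs_le_sum_count hi).trans (Finset.sum_le_sum fun X _ =>
      (hsep X).count_le_greedyCount ?_ ?_ (by simp [hb]))
    · obtain ⟨A, B, hAB, hA, hB⟩ := hT (e i)
      simp only [e.symm_apply_apply] at hA hB
      rw [bexp_of_notMem hT hiI hAB, List.count_append, List.count_cons_self,
        List.count_eq_zero_of_not_mem (dollar_notMem_bexp_of_lt hT hA),
        List.count_eq_zero_of_not_mem (dollar_notMem_bexp_of_lt hT hB)]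
    · rintro c hc (⟨h, rfl⟩ | ⟨j, hj, rfl⟩)
      · exact hash_notMem_bexp hT h _ hc
      · exact dollar_notMem_bexp_of_lt hT (by rintro Y ⟨⟩; simpa using hj) hc
  refine hsub.eq_of_length (le_antisymm hsub.length_le ?_)
  by_contra! hlt
  exact absurd (hmax _ hlt) (by omega)
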